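/- Let p > 3 be a prime. Then ∑_{j=0}^{(p-3)/2} binom((p-1)/2, j) * (-1)^j * (H_{2j} − H_j)/(2j+1) ≡ (-1)^((p+1)/2) * 2 * q_p(2)^2 − E_{p-3} modulo p, where the congruence is understood in the rational numbers. -/

import Mathlib

/-- The Euler numbers, defined by the e.g.f. `2 * exp t / (exp (2*t) + 1)`,
equivalently by `E 0 = 1` and the recurrence coming from `cosh t * sech t = 1`. -/
def eulerNumber : ℕ → ℚ
  | 0 => 1
  | n + 1 => -∑ k ∈ (Finset.range (n + 1)).attach,
      if (n + 1 - k.1) % 2 = 0 then ((n + 1).choose k.1 : ℚ) * eulerNumber k.1 else 0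
  decreasing_by exact Finset.mem_range.mp k.2

open Finset Polynomial

section Identities

variable {K : Type*} [Field K]

/-- The harmonic numbers in a field. -/
def harmonicIn (K : Type*) [Field K] (n : ℕ) : K :=
  ∑ k ∈ range n, 1 / ((k : K) + 1)

lemma harmonicIn_succ (n : ℕ) :
    harmonicIn K (n + 1) = harmonicIn K n + 1 / ((n : K) + 1) :=
  sum_range_succ _ _

/-- The difference `H_{2j} - H_j` in a field. -/
def harmonicGap (K : Type*) [Field K] (j : ℕ) : K :=
  harmonicIn K (2 * j) - harmonicIn K j

/-- The alternating binomial transform of `1 / (2 j + 1)`. -/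
def oddTransform (K : Type*) [Field K] (n : ℕ) : K :=
  ∑ j ∈ range (n + 1), (n.choose j : K) * (-1) ^ j / (2 * (j : K) + 1)

lemma harmonicGap_zero : harmonicGap K 0 = 0 := by simp [harmonicGap]

lemma harmonicGap_succ (j : ℕ) (h2 : (2 : K) ≠ 0) (hj : (j : K) + 1 ≠ 0) :
    harmonicGap K (j + 1) =
      harmonicGap K j + 1 / (2 * (j : K) + 1) - 1 / (2 * ((j : K) + 1)) := by
  have h3 : (2 * (j : K) + 1 + 1) = 2 * (j + 1) := by ring
  simp only [harmonicGap, show 2 * (j + 1) = 2 * j + 1 + 1 by ring, harmonicIn_succ]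
  push_cast
  rw [h3]
  field_simp
  ring

lemma sum_alternating_eq_harmonicGap (j : ℕ) (h2 : (2 : K) ≠ 0)
    (hne : ∀ k : ℕ, 0 < k → k ≤ j → (k : K) ≠ 0) :
    ∑ k ∈ range (2 * j), (-1) ^ k / ((k : K) + 1) = harmonicGap K j := by
  induction j with
  | zero => simp [harmonicGap_zero]
  | succ j ih =>
    have hj : (j : K) + 1 ≠ 0 := by exact_mod_cast hne (j + 1) (by omega) le_rfl
    have h3 : (2 * (j : K) + 1 + 1) = 2 * (j + 1) := by ring
    rw [harmonicGap_succ j h2 hj, show 2 * (j + 1) = 2 * j + 1 + 1 by ring, sum_range_succ,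
      sum_range_succ, ih (fun k h h' => hne k h (by omega))]
    push_cast
    rw [h3]
    have h4 : (-1 : K) ^ (2 * j) = 1 := by simp
    rw [pow_succ, h4]
    ring

/-- Pascal's rule for alternating binomial sums. -/
lemma sum_choose_succ_alternating (n : ℕ) (f : ℕ → K) :
    ∑ j ∈ range (n + 2), ((n + 1).choose j : K) * (-1) ^ j * f j =
      ∑ j ∈ range (n + 1), (n.choose j : K) * (-1) ^ j * f j -
        ∑ j ∈ range (n + 1), (n.choose j : K) * (-1) ^ j * f (j + 1) := by
  have h : ∑ j ∈ range (n + 1), (n.choose j : K) * (-1) ^ j * f j =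
      ∑ j ∈ range (n + 1), (n.choose (j + 1) : K) * (-1) ^ (j + 1) * f (j + 1) + f 0 := by
    have := sum_range_succ' (fun j => (n.choose j : K) * (-1) ^ j * f j) (n + 1)
    rw [sum_range_succ] at this
    simpa using this
  rw [h, sum_range_succ', add_sub_right_comm, ← sum_sub_distrib]
  simp only [Nat.choose_zero_right, Nat.cast_one, pow_zero, mul_one, one_mul, add_left_inj]
  refine sum_congr rfl fun j _ => ?_
  rw [Nat.choose_succ_succ]
  push_cast
  ring

lemma choose_div_succ {m j : ℕ} (hm : (m : K) + 1 ≠ 0) (hj : (j : K) + 1 ≠ 0) :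
    (m.choose j : K) / (j + 1) = ((m + 1).choose (j + 1) : K) / (m + 1) := by
  have := congrArg (Nat.cast : ℕ → K) (Nat.add_one_mul_choose_eq m j)
  push_cast at this
  rw [div_eq_div_iff hj hm]
  linear_combination this

lemma sum_choose_succ_alternating_eq_one (n : ℕ) :
    ∑ j ∈ range (n + 1), ((n + 1).choose (j + 1) : K) * (-1) ^ j = 1 := by
  have h := sum_choose_succ_alternating n (fun _ => (1 : K))
  rw [sub_self, sum_range_succ'] at h
  simp only [pow_succ, mul_one, mul_neg, sum_neg_distrib] at h
  simp at h
  linear_combination -h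

/-- `∑ C(n, j) (-1)^j / (j + 1) = 1 / (n + 1)`. -/
lemma sum_choose_alternating_div_succ (n : ℕ)
    (hne : ∀ k : ℕ, 0 < k → k ≤ n + 1 → (k : K) ≠ 0) :
    ∑ j ∈ range (n + 1), (n.choose j : K) * (-1) ^ j * (1 / ((j : K) + 1)) =
      1 / ((n : K) + 1) := by
  have hn : (n : K) + 1 ≠ 0 := by exact_mod_cast hne (n + 1) (by omega) le_rfl
  refine Eq.trans ?_ (congrArg (· / ((n : K) + 1)) (sum_choose_succ_alternating_eq_one n))
  simp only [sum_div]
  refine sum_congr rfl fun j hj => ?_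
  have hj' : (j : K) + 1 ≠ 0 := by
    exact_mod_cast hne (j + 1) (by omega) (by have := mem_range.1 hj; omega)
  linear_combination (-1) ^ j * choose_div_succ (K := K) hn hj'

/-- `(2 n + 3) g_{n+1} = (2 n + 2) g_n` for the transform `g` of `1 / (2 j + 1)`. -/
lemma oddTransform_succ (n : ℕ)
    (hne : ∀ k : ℕ, 0 < k → k ≤ 2 * n + 3 → (k : K) ≠ 0) :
    (2 * (n : K) + 3) * oddTransform K (n + 1) = 2 * ((n : K) + 1) * oddTransform K n := by
  have h0 := sum_choose_succ_alternating n (fun _ => (1 : K))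
  rw [sub_self] at h0
  have h1 : oddTransform K n =
      ∑ j ∈ range (n + 2), (n.choose j : K) * (-1) ^ j / (2 * (j : K) + 1) := by
    rw [sum_range_succ]; simp [oddTransform]
  rw [h1, oddTransform, mul_sum, mul_sum, ← sub_eq_zero, ← sum_sub_distrib, ← h0]
  refine sum_congr rfl fun j hj => ?_
  have hj1 : 2 * (j : K) + 1 ≠ 0 := by
    exact_mod_cast hne (2 * j + 1) (by omega) (by have := mem_range.1 hj; omega)
  have hc : ((n + 1).choose j : K) * ((n : K) + 1 - j) = (n + 1) * n.choose j := by
    have := congrArg (Nat.cast : ℕ → K) (Nat.choose_mul_succ_eq n j)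
    rw [Nat.cast_mul, Nat.cast_mul, Nat.cast_sub (by have := mem_range.1 hj; omega)] at this
    push_cast at this
    linear_combination -this
  field_simp
  linear_combination 2 * hc

/-- The alternating binomial transform of `H_{2j} - H_j`. -/
lemma sum_choose_alternating_harmonicGap (n : ℕ) (h2 : (2 : K) ≠ 0)
    (hne : ∀ k : ℕ, 0 < k → k ≤ n + 1 → (k : K) ≠ 0) :
    ∑ j ∈ range (n + 2), ((n + 1).choose j : K) * (-1) ^ j * harmonicGap K j =
      1 / (2 * ((n : K) + 1)) - oddTransform K n := by
  rw [sum_choose_succ_alternating, ← sum_sub_distrib]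
  have h := sum_choose_alternating_div_succ n hne
  have : 1 / (2 * ((n : K) + 1)) = 1 / 2 * (1 / ((n : K) + 1)) := by
    rw [one_div_mul_one_div]
  rw [this, ← h, mul_sum, oddTransform, ← sum_sub_distrib]
  refine sum_congr rfl fun j hj => ?_
  have hj1 : (j : K) + 1 ≠ 0 := by
    exact_mod_cast hne (j + 1) (by omega) (by have := mem_range.1 hj; omega)
  rw [harmonicGap_succ j h2 hj1, ← one_div_mul_one_div (2 : K)]
  ring

/-- The alternating binomial transform of `f i / i`, as a function of `n`, has increments given by
the transform of `f`. -/
lemma sum_choose_alternating_div_index_succ (n : ℕ) (f : ℕ → K)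
    (hne : ∀ k : ℕ, 0 < k → k ≤ n + 1 → (k : K) ≠ 0) :
    ∑ i ∈ range (n + 1), ((n + 1).choose (i + 1) : K) * (-1) ^ (i + 1) * f (i + 1) / (i + 1) =
      ∑ i ∈ range n, (n.choose (i + 1) : K) * (-1) ^ (i + 1) * f (i + 1) / (i + 1) +
        (∑ j ∈ range (n + 2), ((n + 1).choose j : K) * (-1) ^ j * f j - f 0) / (n + 1) := by
  have hn : (n : K) + 1 ≠ 0 := by exact_mod_cast hne (n + 1) (by omega) le_rfl
  have h1 : ∑ i ∈ range n, (n.choose (i + 1) : K) * (-1) ^ (i + 1) * f (i + 1) / (i + 1) =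
      ∑ i ∈ range (n + 1),
        (n.choose (i + 1) : K) * (-1) ^ (i + 1) * f (i + 1) / (i + 1) := by
    rw [sum_range_succ]; simp
  rw [h1, sum_range_succ' _ (n + 1)]
  simp only [Nat.choose_zero_right, Nat.cast_one, pow_zero, mul_one, one_mul, add_sub_cancel_right]
  rw [sum_div, ← sum_add_distrib]
  refine sum_congr rfl fun i hi => ?_
  have hi1 : (i : K) + 1 ≠ 0 := by
    exact_mod_cast hne (i + 1) (by omega) (by have := mem_range.1 hi; omega)
  have hc := choose_div_succ (m := n) hn hi1
  have hp : ((n + 1).choose (i + 1) : K) = n.choose i + n.choose (i + 1) := by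
    rw [Nat.choose_succ_succ]; push_cast; rfl
  calc _ = (n.choose (i + 1) : K) * (-1) ^ (i + 1) * f (i + 1) / (i + 1) +
        (-1) ^ (i + 1) * f (i + 1) * ((n.choose i : K) / (i + 1)) := by rw [hp]; ring
    _ = _ := by rw [hc]; ring

/-- `∑_{i ≥ 1} C(n, i) (-1)^i / i = -H_n`. -/
lemma sum_choose_alternating_div_index (n : ℕ)
    (hne : ∀ k : ℕ, 0 < k → k ≤ n → (k : K) ≠ 0) :
    ∑ i ∈ range n, (n.choose (i + 1) : K) * (-1) ^ (i + 1) / (i + 1) = -harmonicIn K n := by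
  induction n with
  | zero => simp [harmonicIn]
  | succ n ih =>
    have h := sum_choose_alternating_div_index_succ n (fun _ => (1 : K)) hne
    have h0 := sum_choose_succ_alternating n (fun _ => (1 : K))
    rw [sub_self] at h0
    rw [h0] at h
    simp only [mul_one] at h
    rw [h, ih (fun k hk hk' => hne k hk (by omega)), harmonicIn_succ]
    ring

/-- The sum over `i ≥ 1` of `C(n, i) (-1)^i (H_{2i} - H_i) / i`. -/
lemma sum_choose_alternating_harmonicGap_div_index (n : ℕ) (h2 : (2 : K) ≠ 0)
    (hne : ∀ k : ℕ, 0 < k → k ≤ n → (k : K) ≠ 0) :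
    ∑ i ∈ range n,
        (n.choose (i + 1) : K) * (-1) ^ (i + 1) * harmonicGap K (i + 1) / (i + 1) =
      ∑ k ∈ range n, (1 / (2 * ((k : K) + 1)) - oddTransform K k) / (k + 1) := by
  induction n with
  | zero => simp
  | succ n ih =>
    rw [sum_choose_alternating_div_index_succ n _ hne,
      ih (fun k hk hk' => hne k hk (by omega)), sum_range_succ _ n,
      sum_choose_alternating_harmonicGap n h2 hne, harmonicGap_zero, sub_zero]

/-- `∑_{k=1}^n (-1)^k / (k² C(n, k)) = ∑_{k=1}^n (1 + 2 (-1)^k) / k²`. -/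
lemma sum_alternating_div_sq_mul_choose (n : ℕ)
    (hne : ∀ k : ℕ, 0 < k → k ≤ n → (k : K) ≠ 0) :
    ∑ k ∈ range n, (-1) ^ (k + 1) / (((k : K) + 1) ^ 2 * (n.choose (k + 1) : K)) =
      ∑ k ∈ range n, (1 + 2 * (-1) ^ (k + 1)) / ((k : K) + 1) ^ 2 := by
  induction n with
  | zero => simp
  | succ n ih =>
    have hfac : ∀ k ≤ n + 1, (k.factorial : K) ≠ 0 := by
      intro k hk
      induction k with
      | zero => simp
      | succ k ihk =>
        rw [Nat.factorial_succ, Nat.cast_mul]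
        exact mul_ne_zero (hne _ (by omega) hk) (ihk (by omega))
    have hn : (n : K) + 1 ≠ 0 := by exact_mod_cast hne (n + 1) (by omega) le_rfl
    rw [sum_range_succ, sum_range_succ, ← ih (fun k hk hk' => hne k hk (by omega))]
    set w : ℕ → K := fun k => (-1) ^ k * k.factorial * (n - k).factorial with hw
    have key : ∀ k ∈ range n,
        (-1) ^ (k + 1) / (((k : K) + 1) ^ 2 * ((n + 1).choose (k + 1) : K)) =
        (-1) ^ (k + 1) / (((k : K) + 1) ^ 2 * (n.choose (k + 1) : K)) +
          (w k - w (k + 1)) / ((n + 1) * (n + 1).factorial) := by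
      intro k hk
      obtain ⟨r, rfl⟩ : ∃ r, n = k + 1 + r := ⟨n - (k + 1), by have := mem_range.1 hk; omega⟩
      have hk1 : (k : K) + 1 ≠ 0 := by exact_mod_cast hne (k + 1) (by omega) (by omega)
      have hr1 : (r : K) + 1 ≠ 0 := by exact_mod_cast hne (r + 1) (by omega) (by omega)
      have hkf := hfac k (by omega)
      have hrf := hfac r (by omega)
      have hnf := hfac (k + 1 + r) (by omega)
      have e1 : ((k + 1 + r + 1).choose (k + 1) : K) * (((k : K) + 1) * k.factorial *
          (((r : K) + 1) * r.factorial)) = ((k : K) + 1 + r + 1) * (k + 1 + r).factorial := by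
        have := Nat.add_choose_mul_factorial_mul_factorial (k + 1) (r + 1)
        rw [← Nat.choose_symm_add] at this
        have := congrArg (Nat.cast : ℕ → K) this
        rw [show k + 1 + (r + 1) = k + 1 + r + 1 by ring, Nat.factorial_succ (k + 1 + r),
          Nat.factorial_succ k, Nat.factorial_succ r] at this
        push_cast at this
        linear_combination this
      have e2 : ((k + 1 + r).choose (k + 1) : K) * (((k : K) + 1) * k.factorial *
          r.factorial) = (k + 1 + r).factorial := by
        have := Nat.add_choose_mul_factorial_mul_factorial (k + 1) r
        rw [← Nat.choose_symm_add] at this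
        have := congrArg (Nat.cast : ℕ → K) this
        rw [Nat.factorial_succ k] at this
        push_cast at this
        linear_combination this
      push_cast at hn
      have c1 : ((k + 1 + r + 1).choose (k + 1) : K) =
          ((k : K) + 1 + r + 1) * (k + 1 + r).factorial / (((k : K) + 1) * k.factorial *
          (((r : K) + 1) * r.factorial)) := by
        rw [eq_div_iff (by simp [hk1, hr1, hkf, hrf])]; exact e1
      have c2 : ((k + 1 + r).choose (k + 1) : K) =
          (k + 1 + r).factorial / (((k : K) + 1) * k.factorial * r.factorial) := by
        rw [eq_div_iff (by simp [hk1, hkf, hrf])]; exact e2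
      rw [c1, c2, hw]
      simp only [show k + 1 + r - k = r + 1 by omega, show k + 1 + r - (k + 1) = r by omega]
      rw [Nat.factorial_succ (k + 1 + r), Nat.factorial_succ k, Nat.factorial_succ r]
      push_cast
      field_simp
      ring
    rw [sum_congr rfl key, sum_add_distrib, ← sum_div, sum_range_sub']
    have hnf := hfac n (by omega)
    rw [hw, Nat.factorial_succ]
    simp only [Nat.choose_self, Nat.factorial_zero, Nat.sub_self, Nat.sub_zero, pow_zero]
    push_cast
    field_simp
    ring

end Identities

section HalfIndex

variable {K : Type*} [Field K] {n : ℕ}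

lemma harmonicIn_two_mul_eq_zero (hn : 2 * (n : K) + 1 = 0) (h2 : (2 : K) ≠ 0) :
    harmonicIn K (2 * n) = 0 := by
  have h : harmonicIn K (2 * n) = -harmonicIn K (2 * n) := by
    conv_lhs => rw [harmonicIn, ← sum_range_reflect]
    rw [harmonicIn, ← sum_neg_distrib]
    refine sum_congr rfl fun k hk => ?_
    have hk := mem_range.1 hk
    rw [Nat.sub_sub, Nat.cast_sub (by omega)]
    push_cast
    rw [show 2 * (n : K) - (1 + k) + 1 = -(k + 1) by linear_combination hn, div_neg]
  have : 2 * harmonicIn K (2 * n) = 0 := by linear_combination h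
  exact (mul_eq_zero.1 this).resolve_left h2

lemma harmonicGap_add_harmonicGap (hn : 2 * (n : K) + 1 = 0) (h2 : (2 : K) ≠ 0)
    (hne : ∀ k : ℕ, 0 < k → k ≤ 2 * n → (k : K) ≠ 0) (i j : ℕ) (hij : j + i = n) :
    harmonicGap K j + harmonicGap K i = -harmonicIn K n := by
  induction i generalizing j with
  | zero =>
    obtain rfl : j = n := by omega
    rw [harmonicGap_zero, harmonicGap, harmonicIn_two_mul_eq_zero hn h2]
    ring
  | succ i ih =>
    have hi1 : (i : K) + 1 ≠ 0 := by exact_mod_cast hne (i + 1) (by omega) (by omega)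
    have hj1 : (j : K) + 1 ≠ 0 := by exact_mod_cast hne (j + 1) (by omega) (by omega)
    have hcast : (n : K) = j + i + 1 := by rw [← hij]; push_cast; ring
    rw [← ih (j + 1) (by omega), harmonicGap_succ i h2 hi1, harmonicGap_succ j h2 hj1,
      show 2 * (j : K) + 1 = -(2 * (i + 1)) by linear_combination hn - 2 * hcast,
      show 2 * ((j : K) + 1) = -(2 * i + 1) by linear_combination hn - 2 * hcast]
    simp only [div_neg]
    ring

lemma oddTransform_mul_choose (hn : 2 * (n : K) + 1 = 0)
    (hne : ∀ k : ℕ, 0 < k → k ≤ 2 * n → (k : K) ≠ 0) (k : ℕ) (hk : k < n) :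
    oddTransform K k * (2 * ((k : K) + 1) * (n.choose (k + 1) : K)) = (-1) ^ (k + 1) := by
  induction k with
  | zero =>
    simp [oddTransform]
    linear_combination hn
  | succ k ih =>
    have hg := oddTransform_succ (K := K) k (fun m h h' => hne m h (by omega))
    have hc : (n.choose (k + 2) : K) * (k + 2) = n.choose (k + 1) * (n - (k + 1)) := by
      have := congrArg (Nat.cast : ℕ → K) (Nat.choose_succ_right_eq n (k + 1))
      rw [Nat.cast_mul, Nat.cast_mul, Nat.cast_sub (by omega)] at this
      push_cast at this
      linear_combination this
    rw [pow_succ, ← ih (by omega)]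
    push_cast
    linear_combination 2 * oddTransform K (k + 1) * hc +
      oddTransform K (k + 1) * n.choose (k + 1) * hn - n.choose (k + 1) * hg

/-- Evaluation of the sum over `i ≥ 1` of `C(n, i) (-1)^i (H_{2i} - H_i) / i` when `2 n + 1 = 0`. -/
lemma sum_choose_harmonicGap_div_index_of_half (hn : 2 * (n : K) + 1 = 0) (h2 : (2 : K) ≠ 0)
    (hne : ∀ k : ℕ, 0 < k → k ≤ 2 * n → (k : K) ≠ 0) :
    ∑ i ∈ range n,
        (n.choose (i + 1) : K) * (-1) ^ (i + 1) * harmonicGap K (i + 1) / (i + 1) =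
      -∑ k ∈ range n, (-1) ^ (k + 1) / ((k : K) + 1) ^ 2 := by
  have hV := sum_alternating_div_sq_mul_choose (K := K) n (fun k h h' => hne k h (by omega))
  rw [sum_choose_alternating_harmonicGap_div_index n h2 (fun k h h' => hne k h (by omega))]
  have h1 : ∀ k ∈ range n, (1 / (2 * ((k : K) + 1)) - oddTransform K k) / (k + 1) =
      1 / 2 * (1 / ((k : K) + 1) ^ 2) -
        1 / 2 * ((-1) ^ (k + 1) / (((k : K) + 1) ^ 2 * (n.choose (k + 1) : K))) := by
    intro k hk
    have hk := mem_range.1 hk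
    have hk1 : (k : K) + 1 ≠ 0 := by exact_mod_cast hne (k + 1) (by omega) (by omega)
    have hg := oddTransform_mul_choose hn hne k hk
    have hc : (n.choose (k + 1) : K) ≠ 0 := by
      intro h0
      rw [h0, mul_zero, mul_zero] at hg
      exact pow_ne_zero (k + 1) (neg_ne_zero.2 one_ne_zero) hg.symm
    rw [← hg]
    field_simp
  rw [sum_congr rfl h1, sum_sub_distrib, ← mul_sum, ← mul_sum, hV, ← mul_sub, ← sum_sub_distrib,
    mul_sum, ← sum_neg_distrib]
  refine sum_congr rfl fun k _ => ?_
  field_simp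
  ring

/-- The sum of `C(n, j) (-1)^j (H_{2j} - H_j) / (2 j + 1)` over `j < n` when `2 n + 1 = 0`. -/
lemma sum_choose_harmonicGap_div_odd (hn : 2 * (n : K) + 1 = 0) (h2 : (2 : K) ≠ 0)
    (hne : ∀ k : ℕ, 0 < k → k ≤ 2 * n → (k : K) ≠ 0) :
    ∑ j ∈ range n, (n.choose j : K) * (-1) ^ j * harmonicGap K j / (2 * (j : K) + 1) =
      -((-1) ^ n / 2 * (∑ k ∈ range n, (-1) ^ (k + 1) / ((k : K) + 1) ^ 2 +
        harmonicIn K n ^ 2)) := by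
  have h1 := sum_choose_harmonicGap_div_index_of_half hn h2 hne
  have h3 := sum_choose_alternating_div_index (K := K) n (fun k h h' => hne k h (by omega))
  rw [← sum_range_reflect]
  have key : ∀ i ∈ range n, (n.choose (n - 1 - i) : K) * (-1) ^ (n - 1 - i) *
      harmonicGap K (n - 1 - i) / (2 * ((n - 1 - i : ℕ) : K) + 1) =
      (-1) ^ n / 2 * ((n.choose (i + 1) : K) * (-1) ^ (i + 1) * harmonicGap K (i + 1) / (i + 1)) +
      (-1) ^ n / 2 * harmonicIn K n * ((n.choose (i + 1) : K) * (-1) ^ (i + 1) / (i + 1)) := by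
    intro i hi
    obtain ⟨r, hr⟩ : ∃ r, n = r + (i + 1) := ⟨n - (i + 1), by have := mem_range.1 hi; omega⟩
    have hi1 : (i : K) + 1 ≠ 0 := by exact_mod_cast hne (i + 1) (by omega) (by omega)
    have hG := harmonicGap_add_harmonicGap hn h2 hne (i + 1) r hr.symm
    have hcast : (n : K) = r + i + 1 := by rw [hr]; push_cast; ring
    have hsign : (-1 : K) ^ n * (-1) ^ (i + 1) = (-1) ^ r := by
      rw [hr, pow_add, mul_assoc, ← mul_pow]
      simp
    have hch : n.choose (i + 1) = n.choose r := by rw [hr]; exact Nat.choose_symm_add.symm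
    rw [show n - 1 - i = r by omega, hch, ← hsign,
      show 2 * (r : K) + 1 = -(2 * (i + 1)) by linear_combination hn - 2 * hcast,
      eq_sub_of_add_eq hG]
    field_simp
    ring
  rw [sum_congr rfl key, sum_add_distrib, ← mul_sum, ← mul_sum, h1, h3]
  ring

end HalfIndex

section EulerNumbers

variable {K : Type*} [Field K]

/-- The recurrence for Euler numbers, for a sequence in a ring. -/
def IsEulerSeq {R : Type*} [Ring R] (E : ℕ → R) : Prop :=
  E 0 = 1 ∧ ∀ n, E (n + 1) = -∑ k ∈ range (n + 1),
    if (n + 1 - k) % 2 = 0 then ((n + 1).choose k : R) * E k else 0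

lemma IsEulerSeq.odd_eq_zero {E : ℕ → K} (hE : IsEulerSeq E) (n : ℕ) (hn : n % 2 = 1) :
    E n = 0 := by
  induction n using Nat.strong_induction_on with
  | _ n ih =>
    obtain ⟨m, rfl⟩ : ∃ m, n = m + 1 := ⟨n - 1, by omega⟩
    rw [hE.2, neg_eq_zero]
    refine sum_eq_zero fun k hk => ?_
    have hk := mem_range.1 hk
    split_ifs with h
    · rw [ih k hk (by omega), mul_zero]
    · rfl

lemma IsEulerSeq.sum_choose {E : ℕ → K} (hE : IsEulerSeq E) (n : ℕ) :
    ∑ k ∈ range (n + 1), (1 + (-1) ^ (n - k)) * ((n.choose k : K) * E k) =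
      2 * (0 : K) ^ n := by
  cases n with
  | zero => simp [hE.1]; norm_num
  | succ n =>
    rw [sum_range_succ, hE.2]
    simp only [Nat.sub_self, pow_zero, Nat.choose_self, Nat.cast_one, one_mul]
    rw [mul_neg, mul_sum, ← sub_eq_add_neg, ← sum_sub_distrib, zero_pow (by omega), mul_zero]
    refine sum_eq_zero fun k _ => ?_
    split_ifs with h
    · rw [(Nat.even_iff.2 h).neg_one_pow]; ring
    · rw [(Nat.odd_iff.2 (by omega)).neg_one_pow]; ring

/-- The linear functional on polynomials sending `X ^ k` to `E k`. -/
noncomputable def umbral (E : ℕ → K) : K[X] →ₗ[K] K :=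
  (basisMonomials K).constr K E

lemma umbral_X_pow (E : ℕ → K) (k : ℕ) : umbral E (X ^ k) = E k := by
  rw [X_pow_eq_monomial, ← congrFun (coe_basisMonomials K) k, umbral, Module.Basis.constr_basis]

lemma umbral_X_add_C_pow (E : ℕ → K) (c : K) (n : ℕ) :
    umbral E ((X + C c) ^ n) =
      ∑ k ∈ range (n + 1), c ^ (n - k) * ((n.choose k : K) * E k) := by
  rw [add_pow, map_sum]
  refine sum_congr rfl fun k _ => ?_
  rw [show (X : K[X]) ^ k * C c ^ (n - k) * (n.choose k : K[X]) =
    (c ^ (n - k) * (n.choose k : K)) • X ^ k by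
      rw [smul_eq_C_mul, C_mul, C_pow, ← C_eq_natCast]; ring]
  rw [map_smul, umbral_X_pow, smul_eq_mul, mul_assoc]

lemma IsEulerSeq.umbral_shift {E : ℕ → K} (hE : IsEulerSeq E) (P : K[X]) :
    umbral E (aeval (X + C 1 : K[X]) P) + umbral E (aeval (X + C (-1) : K[X]) P) =
      2 * P.eval 0 := by
  induction P using Polynomial.induction_on' with
  | add P Q hP hQ =>
    simp only [map_add, eval_add]
    linear_combination hP + hQ
  | monomial n a =>
    rw [← C_mul_X_pow_eq_monomial, ← smul_eq_C_mul]
    simp only [map_smul, map_pow, aeval_X, umbral_X_add_C_pow, smul_eq_mul, eval_smul, eval_pow,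
      eval_X]
    rw [← mul_add, ← sum_add_distrib, mul_left_comm, ← hE.sum_choose]
    simp only [one_pow, add_mul]

/-- Alternating power sums expressed through Euler numbers, when `2 n + 1 = 0`. -/
lemma IsEulerSeq.sum_alternating_pow {E : ℕ → K} (hE : IsEulerSeq E) (h2 : (2 : K) ≠ 0) {n m : ℕ}
    (hn : 2 * (n : K) + 1 = 0) (hm : Even m) (hm0 : m ≠ 0) :
    2 * ∑ k ∈ range n, (-1) ^ (k + 1) * (2 * ((k : K) + 1)) ^ m = (-1) ^ n * E m := by
  set e : K → K := fun c => umbral E ((X + C c) ^ m) with he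
  have shift : ∀ c, e (c + 1) + e (c - 1) = 2 * c ^ m := by
    intro c
    have h := hE.umbral_shift ((X + C c) ^ m)
    simp only [map_pow, map_add, aeval_X, aeval_C, eval_pow, eval_add, eval_X, eval_C,
      zero_add] at h
    rw [← h, he]
    simp only [sub_eq_add_neg, C_add, algebraMap_eq, add_assoc, add_comm (C c)]
  have hodd : e (-1) = e 1 := by
    simp only [he, umbral_X_add_C_pow]
    refine sum_congr rfl fun k hk => ?_
    have hk := mem_range.1 hk
    rcases Nat.mod_two_eq_zero_or_one k with h | h
    · rw [Even.neg_pow (by grind)]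
    · rw [hE.odd_eq_zero k h]; simp
  have he1 : e 1 = 0 := by
    have h := shift 0
    rw [zero_add, zero_sub, hodd, zero_pow hm0] at h
    have : 2 * e 1 = 0 := by linear_combination h
    exact (mul_eq_zero.1 this).resolve_left h2
  have tele : ∀ r : ℕ, 2 * ∑ k ∈ range r, (-1) ^ (k + 1) * (2 * ((k : K) + 1)) ^ m =
      (-1) ^ r * e (2 * r + 1) := by
    intro r
    induction r with
    | zero => simp [he1]
    | succ r ih =>
      have h := shift (2 * ((r : K) + 1))
      rw [show 2 * ((r : K) + 1) - 1 = 2 * r + 1 by ring] at h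
      rw [sum_range_succ, mul_add, ih]
      push_cast
      rw [pow_succ]
      linear_combination (-1) ^ (r + 1) * -1 * h
  rw [tele, hn, he]
  simp [umbral_X_pow]

end EulerNumbers

section Reduction

variable {p : ℕ} [Fact p.Prime]

/-- The rational number `q` is `p`-integral with residue `x`. -/
def ReducesTo (p : ℕ) [Fact p.Prime] (q : ℚ) (x : ZMod p) : Prop :=
  ∃ a b : ℤ, (b : ZMod p) ≠ 0 ∧ q * b = a ∧ x * b = a

namespace ReducesTo

lemma intCast (z : ℤ) : ReducesTo p z z := ⟨z, 1, by simp, by simp, by simp⟩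

lemma natCast (z : ℕ) : ReducesTo p z z := by simpa using intCast (p := p) z

lemma add {q r : ℚ} {x y : ZMod p} : ReducesTo p q x → ReducesTo p r y →
    ReducesTo p (q + r) (x + y) := by
  rintro ⟨a, b, hb, h1, h2⟩ ⟨c, d, hd, h3, h4⟩
  refine ⟨a * d + c * b, b * d, by push_cast; exact mul_ne_zero hb hd, ?_, ?_⟩
  · push_cast; linear_combination d * h1 + b * h3
  · push_cast; linear_combination d * h2 + b * h4

lemma mul {q r : ℚ} {x y : ZMod p} : ReducesTo p q x → ReducesTo p r y →
    ReducesTo p (q * r) (x * y) := by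
  rintro ⟨a, b, hb, h1, h2⟩ ⟨c, d, hd, h3, h4⟩
  refine ⟨a * c, b * d, by push_cast; exact mul_ne_zero hb hd, ?_, ?_⟩
  · push_cast; linear_combination r * d * h1 + a * h3
  · push_cast; linear_combination y * d * h2 + a * h4

lemma sub {q r : ℚ} {x y : ZMod p} (h : ReducesTo p q x) (h' : ReducesTo p r y) :
    ReducesTo p (q - r) (x - y) := by
  simpa [sub_eq_add_neg] using h.add ((intCast (p := p) (-1)).mul h')

lemma pow {q : ℚ} {x : ZMod p} (h : ReducesTo p q x) (k : ℕ) : ReducesTo p (q ^ k) (x ^ k) := by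
  induction k with
  | zero => simpa using natCast (p := p) 1
  | succ k ih => simpa only [pow_succ] using ih.mul h

lemma div_natCast {q : ℚ} {x : ZMod p} {k : ℕ} (h : ReducesTo p q x) (hk : (k : ZMod p) ≠ 0) :
    ReducesTo p (q / k) (x / k) := by
  have hk' : (k : ℚ) ≠ 0 := by rintro h0; rw [Nat.cast_eq_zero] at h0; simp [h0] at hk
  obtain ⟨a, b, hb, h1, h2⟩ := h
  refine ⟨a, b * k, by push_cast; exact mul_ne_zero hb hk, ?_, ?_⟩
  · push_cast; rw [← h1]; field_simp
  · push_cast; rw [← h2]; field_simp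

lemma sum {ι : Type*} (s : Finset ι) {f : ι → ℚ} {g : ι → ZMod p}
    (h : ∀ i ∈ s, ReducesTo p (f i) (g i)) : ReducesTo p (∑ i ∈ s, f i) (∑ i ∈ s, g i) := by
  classical
  induction s using Finset.induction_on with
  | empty => simpa using natCast (p := p) 0
  | insert i s hi ih =>
    rw [sum_insert hi, sum_insert hi]
    exact (h i (mem_insert_self i s)).add (ih fun j hj => h j (mem_insert_of_mem hj))

lemma harmonic {m : ℕ} (hm : m < p) : ReducesTo p (harmonic m) (harmonicIn (ZMod p) m) := by
  refine sum _ fun k hk => ?_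
  have hk := mem_range.1 hk
  have h0 : ((k + 1 : ℕ) : ZMod p) ≠ 0 := by
    rw [Ne, ZMod.natCast_eq_zero_iff]
    exact Nat.not_dvd_of_pos_of_lt (by omega) (by omega)
  simpa using (natCast (p := p) 1).div_natCast h0

lemma dvd_num {q : ℚ} (h : ReducesTo p q 0) : (p : ℤ) ∣ q.num := by
  obtain ⟨a, b, hb, h1, h2⟩ := h
  rw [zero_mul, eq_comm, ZMod.intCast_zmod_eq_zero_iff_dvd] at h2
  rw [Ne, ZMod.intCast_zmod_eq_zero_iff_dvd] at hb
  have h3 : q.num * b = a * q.den := by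
    have := Rat.mul_den_eq_num q
    have : (q.num * b : ℚ) = a * q.den := by rw [← this, ← h1]; ring
    exact_mod_cast this
  have h4 : (p : ℤ) ∣ q.num * b := h3 ▸ h2.mul_right _
  exact ((Nat.prime_iff_prime_int.1 (Fact.out : p.Prime)).dvd_or_dvd h4).resolve_right hb

end ReducesTo

lemma choose_prime_sub_one (k : ℕ) (hk : k < p) :
    ((p - 1).choose k : ZMod p) = (-1) ^ k := by
  induction k with
  | zero => simp
  | succ k ih =>
    have hp : p.Prime := Fact.out
    have h := (ZMod.natCast_eq_zero_iff _ _).2 (hp.dvd_choose_self (Nat.succ_ne_zero k) hk)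
    rw [show p.choose (k + 1) = (p - 1 + 1).choose (k + 1) by rw [Nat.sub_add_cancel hp.one_le],
      Nat.choose_succ_succ] at h
    push_cast at h
    rw [ih (by omega)] at h
    rw [pow_succ]
    linear_combination h

/-- Twice the Fermat quotient `q_p(2)` is the alternating harmonic sum of length `p - 1`. -/
lemma two_mul_fermatQuotient {Q : ℤ} (hQ : (2 : ℤ) ^ (p - 1) = 1 + p * Q) :
    2 * (Q : ZMod p) = ∑ k ∈ range (p - 1), (-1) ^ k / ((k : ZMod p) + 1) := by
  have hp : p.Prime := Fact.out
  have hp1 : p - 1 + 1 = p := Nat.sub_add_cancel hp.one_le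
  have hdvd : ∀ k, k < p - 1 → p ∣ p.choose (k + 1) := fun k hk =>
    hp.dvd_choose_self (Nat.succ_ne_zero k) (by omega)
  have hsum : (2 : ℤ) * Q = ∑ k ∈ range (p - 1), ((p.choose (k + 1) / p : ℕ) : ℤ) := by
    have h1 := Nat.sum_range_choose p
    rw [sum_range_succ, ← hp1, sum_range_succ'] at h1
    rw [hp1] at h1
    have h2 : ∑ k ∈ range (p - 1), p.choose (k + 1) =
        p * ∑ k ∈ range (p - 1), p.choose (k + 1) / p := by
      rw [mul_sum]
      exact sum_congr rfl fun k hk => (Nat.mul_div_cancel' (hdvd k (mem_range.1 hk))).symm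
    rw [h2] at h1
    have h3 : (2 : ℤ) ^ p = 2 * (1 + p * Q) := by rw [← hQ, ← pow_succ', hp1]
    have h4 := congrArg (Nat.cast : ℕ → ℤ) h1
    simp only [Nat.choose_zero_right, Nat.choose_self] at h4
    push_cast at h4
    rw [h3] at h4
    have hp0 : (p : ℤ) ≠ 0 := by exact_mod_cast hp.ne_zero
    apply mul_left_cancel₀ hp0
    push_cast
    linear_combination -h4
  have hsum' := congrArg (Int.cast : ℤ → ZMod p) hsum
  push_cast at hsum'
  rw [hsum']
  refine sum_congr rfl fun k hk => ?_
  have hk := mem_range.1 hk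
  have h0 : (k : ZMod p) + 1 ≠ 0 := by
    have : ((k + 1 : ℕ) : ZMod p) ≠ 0 := by
      rw [Ne, ZMod.natCast_eq_zero_iff]
      exact Nat.not_dvd_of_pos_of_lt (by omega) (by omega)
    exact_mod_cast this
  rw [eq_div_iff h0, ← choose_prime_sub_one k (by omega)]
  have h5 : p.choose (k + 1) / p * (k + 1) = (p - 1).choose k := by
    have h6 := Nat.add_one_mul_choose_eq (p - 1) k
    rw [hp1] at h6
    apply Nat.eq_of_mul_eq_mul_left hp.pos
    rw [h6, ← mul_assoc, Nat.mul_div_cancel' (hdvd k hk)]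
  exact_mod_cast congrArg (Nat.cast : ℕ → ZMod p) h5

end Reduction

lemma eulerNumber_isEulerSeq : IsEulerSeq eulerNumber := by
  refine ⟨by rw [eulerNumber], fun n => ?_⟩
  rw [eulerNumber, sum_attach (range (n + 1)) fun k =>
    if (n + 1 - k) % 2 = 0 then ((n + 1).choose k : ℚ) * eulerNumber k else 0]

lemma exists_int_eulerNumber (n : ℕ) : ∃ z : ℤ, eulerNumber n = z := by
  induction n using Nat.strong_induction_on with
  | _ n ih =>
    cases n with
    | zero => exact ⟨1, by rw [eulerNumber_isEulerSeq.1]; simp⟩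
    | succ n =>
      choose! z hz using ih
      refine ⟨-∑ k ∈ range (n + 1),
        if (n + 1 - k) % 2 = 0 then ((n + 1).choose k : ℤ) * z k else 0, ?_⟩
      rw [eulerNumber_isEulerSeq.2]
      push_cast
      refine congrArg _ (sum_congr rfl fun k hk => ?_)
      rw [hz k (mem_range.1 hk)]

lemma exists_int_isEulerSeq :
    ∃ z : ℕ → ℤ, (∀ n, eulerNumber n = z n) ∧
      ∀ (K : Type) [Field K], IsEulerSeq fun n => (z n : K) := by
  choose z hz using exists_int_eulerNumber
  have hz' : IsEulerSeq z := by
    have h := eulerNumber_isEulerSeq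
    refine ⟨by have := h.1; rw [hz] at this; exact_mod_cast this, fun n => ?_⟩
    have := h.2 n
    simp only [hz] at this
    exact_mod_cast this
  refine ⟨z, hz, fun K _ => ⟨by simp [hz'.1], fun n => ?_⟩⟩
  simp only [hz'.2]
  push_cast
  rfl

/-- For a prime `p > 3`,
`∑_{j=0}^{(p-3)/2} C((p-1)/2, j) (-1)^j (H_{2j} - H_j)/(2j+1)
  ≡ (-1)^((p+1)/2) 2 q_p(2)^2 - E_{p-3} (mod p)` as rational numbers,
where `q_p(2) = (2^{p-1} - 1)/p` is the Fermat quotient. -/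
theorem sum_harmonic_congruence (p : ℕ) (hp : p.Prime) (hp3 : 3 < p) :
    (p : ℤ) ∣
      ((∑ j ∈ Finset.range ((p - 3) / 2 + 1),
          (((p - 1) / 2).choose j : ℚ) * (-1) ^ j * (harmonic (2 * j) - harmonic j) /
            (2 * (j : ℚ) + 1)) -
        ((-1) ^ ((p + 1) / 2) * 2 * (((2 : ℚ) ^ (p - 1) - 1) / (p : ℚ)) ^ 2 -
          eulerNumber (p - 3))).num := by
  have : Fact p.Prime := ⟨hp⟩
  obtain ⟨n, rfl⟩ : ∃ n, p = 2 * n + 1 := (hp.odd_of_ne_two (by omega))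
  have hn2 : 2 ≤ n := by omega
  rw [show (2 * n + 1 - 3) / 2 + 1 = n by omega, show (2 * n + 1 - 1) / 2 = n by omega,
    show (2 * n + 1 + 1) / 2 = n + 1 by omega, show 2 * n + 1 - 1 = 2 * n by omega]
  have hn : 2 * (n : ZMod (2 * n + 1)) + 1 = 0 := by
    exact_mod_cast ZMod.natCast_self (2 * n + 1)
  have hne : ∀ k : ℕ, 0 < k → k ≤ 2 * n → (k : ZMod (2 * n + 1)) ≠ 0 := by
    intro k h h'
    rw [Ne, ZMod.natCast_eq_zero_iff]
    exact Nat.not_dvd_of_pos_of_lt h (by omega)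
  have h2 : (2 : ZMod (2 * n + 1)) ≠ 0 := by exact_mod_cast hne 2 (by omega) (by omega)
  obtain ⟨z, hz, hzE⟩ := exists_int_isEulerSeq
  have hE := (hzE (ZMod (2 * n + 1))).sum_alternating_pow h2 hn
    (m := 2 * n + 1 - 3) (by rw [Nat.even_iff]; omega) (by omega)
  obtain ⟨Q, hQ⟩ : ∃ Q : ℤ, (2 : ℤ) ^ (2 * n) = 1 + (2 * n + 1 : ℕ) * Q := by
    have h := ZMod.pow_card_sub_one_eq_one h2
    rw [Nat.add_sub_cancel] at h
    have h' : ((2 ^ (2 * n) - 1 : ℤ) : ZMod (2 * n + 1)) = 0 := by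
      push_cast
      rw [h, sub_self]
    obtain ⟨Q, hQ⟩ := (ZMod.intCast_zmod_eq_zero_iff_dvd _ _).1 h'
    exact ⟨Q, by linear_combination hQ⟩
  have hfermat : 2 * (Q : ZMod (2 * n + 1)) = -harmonicIn (ZMod (2 * n + 1)) n := by
    have h := two_mul_fermatQuotient (p := 2 * n + 1) hQ
    rw [Nat.add_sub_cancel, sum_alternating_eq_harmonicGap n h2
      (fun k h h' => hne k h (by omega)), harmonicGap, harmonicIn_two_mul_eq_zero hn h2] at h
    rw [h, zero_sub]
  have hquot : ((2 : ℚ) ^ (2 * n) - 1) / ((2 * n + 1 : ℕ) : ℚ) = Q := by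
    have h : (2 : ℚ) ^ (2 * n) = 1 + (2 * n + 1 : ℕ) * Q := by exact_mod_cast hQ
    have h0 : ((2 * n + 1 : ℕ) : ℚ) ≠ 0 := by positivity
    rw [h, div_eq_iff h0]
    ring
  have hpow : ∀ k ∈ range n, (-1) ^ (k + 1) / ((k : ZMod (2 * n + 1)) + 1) ^ 2 =
      4 * ((-1) ^ (k + 1) * (2 * ((k : ZMod (2 * n + 1)) + 1)) ^ (2 * n + 1 - 3)) := by
    intro k hk
    have hk0 : (k : ZMod (2 * n + 1)) + 1 ≠ 0 := by
      exact_mod_cast hne (k + 1) (by omega) (by have := mem_range.1 hk; omega)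
    have h := ZMod.pow_card_sub_one_eq_one (mul_ne_zero h2 hk0)
    rw [show 2 * n + 1 - 1 = 2 * n + 1 - 3 + 2 by omega, pow_add] at h
    rw [div_eq_iff (pow_ne_zero 2 hk0)]
    linear_combination -(-1) ^ (k + 1) * h
  have hsum := sum_choose_harmonicGap_div_odd hn h2 hne
  rw [sum_congr rfl hpow, ← mul_sum] at hsum
  apply ReducesTo.dvd_num
  rw [hquot, hz]
  have hred : ReducesTo (2 * n + 1)
      (∑ j ∈ range n, (n.choose j : ℚ) * (-1) ^ j * (harmonic (2 * j) - harmonic j) /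
        (2 * (j : ℚ) + 1))
      (∑ j ∈ range n, (n.choose j : ZMod (2 * n + 1)) * (-1) ^ j *
        harmonicGap (ZMod (2 * n + 1)) j / (2 * (j : ZMod (2 * n + 1)) + 1)) := by
    refine ReducesTo.sum _ fun j hj => ?_
    have hj := mem_range.1 hj
    have h := (((ReducesTo.natCast (p := 2 * n + 1) (n.choose j)).mul
      ((ReducesTo.intCast (-1)).pow j)).mul
      ((ReducesTo.harmonic (p := 2 * n + 1) (m := 2 * j) (by omega)).sub
        (ReducesTo.harmonic (m := j) (by omega)))).div_natCast
      (hne (2 * j + 1) (by omega) (by omega))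
    simpa [harmonicGap] using h
  have hrhs := ((((ReducesTo.intCast (p := 2 * n + 1) (-1)).pow (n + 1)).mul
    (ReducesTo.natCast 2)).mul ((ReducesTo.intCast Q).pow 2)).sub
    (ReducesTo.intCast (z (2 * n + 1 - 3)))
  have h := hred.sub hrhs
  rw [hsum] at h
  simp only [Int.cast_neg, Int.cast_one, Nat.cast_ofNat] at h
  convert h using 1
  have hsq : ((-1 : ZMod (2 * n + 1)) ^ n) ^ 2 = 1 := by
    rw [← pow_mul, pow_mul', neg_one_sq, one_pow]
  set s := ∑ k ∈ range n, (-1) ^ (k + 1) * (2 * ((k : ZMod (2 * n + 1)) + 1)) ^ (2 * n + 1 - 3)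
  have hs : -((-1) ^ n * (2 * s)) = -(z (2 * n + 1 - 3) : ZMod (2 * n + 1)) := by
    rw [hE]
    linear_combination -(z (2 * n + 1 - 3) : ZMod (2 * n + 1)) * hsq
  have hH : harmonicIn (ZMod (2 * n + 1)) n = -(2 * Q) := by rw [hfermat, neg_neg]
  rw [hH, pow_succ]
  field_simp
  linear_combination -2 * hs
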